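/- arXiv:1510.06580 — 2 statements merged into one kernel-verified Lean document; each statement's English description precedes it below -/
import Mathlib

section
/- Define ℂ-linear maps ρg and ρh on R by ρg(p) = i·g*(p) and ρh(p) = −h*(p), where i ∈ ℂ is the imaginary unit. Then for every p ∈ W: ρg(ρg(ρg(ρg(p)))) = p, ρh(ρh(ρh(ρh(p)))) = p, and ρg(ρh(p)) = ρh(ρg(ρg(ρg(p)))). Hence ρg and ρh define a linear representation on W of the group ℤ/4 ⋉ ℤ/4 = ⟨g, h | g⁴ = h⁴ = 1, gh = hg³⟩. -/
open MvPolynomial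

noncomputable section

abbrev R : Type := MvPolynomial (Fin 4 × Fin 2) ℂ

/-- The variable `x_{i+1, j}` of the paper. -/
def x (i : Fin 4) (j : Fin 2) : R := MvPolynomial.X (i, j)

/-- The algebra automorphism `g*`:
`g*(x_{1a}) = x_{2a}`, `g*(x_{2b}) = (-1)^b x_{1b}`,
`g*(x_{3c}) = x_{4c}`, `g*(x_{4d}) = (-1)^d x_{3d}`. -/
def gstar : R →ₐ[ℂ] R :=
  aeval fun p =>
    ![fun j => x 1 j,
      fun j => ((-1 : ℂ) ^ (j : ℕ)) • x 0 j,
      fun j => x 3 j,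
      fun j => ((-1 : ℂ) ^ (j : ℕ)) • x 2 j] p.1 p.2

/-- The algebra automorphism `h*`:
`h*(x_{1a}) = x_{3,1-a}`, `h*(x_{2b}) = (-1)^{1-b} x_{4,1-b}`,
`h*(x_{3c}) = x_{1c}`, `h*(x_{4d}) = (-1)^d x_{2d}`. -/
def hstar : R →ₐ[ℂ] R :=
  aeval fun p =>
    ![fun j => x 2 (j + 1),
      fun j => ((-1 : ℂ) ^ (1 - (j : ℕ))) • x 3 (j + 1),
      fun j => x 0 j,
      fun j => ((-1 : ℂ) ^ (j : ℕ)) • x 1 j] p.1 p.2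

/-- `W`, the span of the 16 multidegree-(1,1,1,1) monomials,
a model for `H^0((ℙ¹)⁴, O(1,1,1,1))`. -/
def W : Submodule ℂ R :=
  Submodule.span ℂ {q | ∃ a b c d : Fin 2, q = x 0 a * x 1 b * x 2 c * x 3 d}

/-- `ρ₁(g) = i·g*`. -/
def ρg (p : R) : R := Complex.I • gstar p

/-- `ρ₁(h) = -h*`. -/
def ρh (p : R) : R := - hstar p

lemma gstar_x_zero (j : Fin 2) : gstar (x 0 j) = x 1 j := by
  simp [gstar, x]

lemma gstar_x_one (j : Fin 2) : gstar (x 1 j) = (-1 : ℂ) ^ (j : ℕ) • x 0 j := by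
  simp [gstar, x]

lemma gstar_x_two (j : Fin 2) : gstar (x 2 j) = x 3 j := by
  simp [gstar, x]

lemma gstar_x_three (j : Fin 2) : gstar (x 3 j) = (-1 : ℂ) ^ (j : ℕ) • x 2 j := by
  simp [gstar, x]

lemma hstar_x_zero (j : Fin 2) : hstar (x 0 j) = x 2 (j + 1) := by
  simp [hstar, x]

lemma hstar_x_one (j : Fin 2) :
    hstar (x 1 j) = (-1 : ℂ) ^ (1 - (j : ℕ)) • x 3 (j + 1) := by
  simp [hstar, x]

lemma hstar_x_two (j : Fin 2) : hstar (x 2 j) = x 0 j := by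
  simp [hstar, x]

lemma hstar_x_three (j : Fin 2) : hstar (x 3 j) = (-1 : ℂ) ^ (j : ℕ) • x 1 j := by
  simp [hstar, x]

/-- `g*` has order dividing four on all of `R`. -/
lemma gstar_pow_four (p : R) : gstar (gstar (gstar (gstar p))) = p := by
  suffices h : gstar.comp (gstar.comp (gstar.comp gstar)) = AlgHom.id ℂ R from
    DFunLike.congr_fun h p
  refine MvPolynomial.algHom_ext fun ⟨i, j⟩ => ?_
  change gstar (gstar (gstar (gstar (x i j)))) = x i j
  fin_cases i <;> fin_cases j <;>
    simp [gstar_x_zero, gstar_x_one, gstar_x_two, gstar_x_three]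

/-- `h*` has order dividing four on all of `R`. -/
lemma hstar_pow_four (p : R) : hstar (hstar (hstar (hstar p))) = p := by
  suffices h : hstar.comp (hstar.comp (hstar.comp hstar)) = AlgHom.id ℂ R from
    DFunLike.congr_fun h p
  refine MvPolynomial.algHom_ext fun ⟨i, j⟩ => ?_
  change hstar (hstar (hstar (hstar (x i j)))) = x i j
  fin_cases i <;> fin_cases j <;>
    simp [hstar_x_zero, hstar_x_one, hstar_x_two, hstar_x_three]

/-- On the variables, `g* h*` and `h* (g*)³` agree up to a sign, which is `-1` exactly on `x_{1j}`. -/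
lemma gstar_hstar_x (i : Fin 4) (j : Fin 2) :
    gstar (hstar (x i j)) =
      (if i = 0 then -1 else 1) * hstar (gstar (gstar (gstar (x i j)))) := by
  fin_cases i <;> fin_cases j <;>
    simp [gstar_x_zero, gstar_x_one, gstar_x_two, gstar_x_three,
      hstar_x_zero, hstar_x_one, hstar_x_two, hstar_x_three]

lemma gstar_hstar_of_mem_W {p : R} (hp : p ∈ W) :
    gstar (hstar p) = -hstar (gstar (gstar (gstar p))) := by
  induction hp using Submodule.span_induction with
  | mem q hq =>
    obtain ⟨a, b, c, d, rfl⟩ := hq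
    simp [gstar_hstar_x]
  | zero => simp
  | add p q _ _ hp hq => simp only [map_add, hp, hq, neg_add]
  | smul c p _ hp => simp only [map_smul, hp, smul_neg]

/-- `ρg` and `ρh` define on `W` a representation of
`ℤ/4 ⋉ ℤ/4 = ⟨g, h | g⁴ = h⁴ = 1, gh = hg³⟩`. -/
theorem stmt_2 :
    ∀ p ∈ W,
      ρg (ρg (ρg (ρg p))) = p ∧
      ρh (ρh (ρh (ρh p))) = p ∧
      ρg (ρh p) = ρh (ρg (ρg (ρg p))) := by
  intro p hp
  refine ⟨?_, ?_, ?_⟩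
  · simp [ρg, smul_smul, gstar_pow_four]
  · simp [ρh, hstar_pow_four]
  · simp [ρg, ρh, smul_smul, gstar_hstar_of_mem_W hp]
end
end

section
/- Every polynomial p ∈ R that is multihomogeneous of multidegree (2,2,2,2) (i.e. of degree 2 in each of the four pairs of variables (x_{i0}, x_{i1})) and satisfies g*(p) = p and h*(p) = p is a ℂ-linear combination of U0, U1, U2, U3, U4, U5; moreover U0,…,U5 are linearly independent over ℂ. In particular U0,…,U5 form a basis of the 6-dimensional space H⁰(O(2,2,2,2))^{−,+}. -/
open MvPolynomial

noncomputable section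

def U0 : R :=
  x 1 0 * x 1 1 * x 2 0 * x 2 1 * (x 0 0 ^ 2 + x 0 1 ^ 2) * (x 3 0 ^ 2 + x 3 1 ^ 2) -
    x 0 0 * x 0 1 * x 3 0 * x 3 1 * (x 1 0 ^ 2 + x 1 1 ^ 2) * (x 2 0 ^ 2 + x 2 1 ^ 2)

def U1 : R :=
  x 0 0 * x 0 1 * x 2 0 * x 2 1 * (x 1 0 ^ 2 + x 1 1 ^ 2) * (x 3 0 ^ 2 + x 3 1 ^ 2) +
    x 1 0 * x 1 1 * x 3 0 * x 3 1 * (x 0 0 ^ 2 + x 0 1 ^ 2) * (x 2 0 ^ 2 + x 2 1 ^ 2)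

def U2 : R :=
  (x 0 0 ^ 2 * x 1 0 ^ 2 + x 0 1 ^ 2 * x 1 1 ^ 2) *
    (x 2 0 ^ 2 * x 3 0 ^ 2 + x 2 1 ^ 2 * x 3 1 ^ 2)

def U3 : R :=
  (x 0 1 ^ 2 * x 1 0 ^ 2 + x 0 0 ^ 2 * x 1 1 ^ 2) *
    (x 2 1 ^ 2 * x 3 0 ^ 2 + x 2 0 ^ 2 * x 3 1 ^ 2)

def U4 : R :=
  4 * (x 0 0 * x 0 1 * x 1 0 * x 1 1 * x 2 0 * x 2 1 * x 3 0 * x 3 1)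

def U5 : R :=
  U0 + C (1 / 2 : ℂ) * U2 + C (1 / 2 : ℂ) * U3 + U4 -
    C (1 / 2 : ℂ) *
      ((x 0 0 ^ 2 + x 0 1 ^ 2) * (x 1 0 ^ 2 + x 1 1 ^ 2) * (x 2 0 ^ 2 + x 2 1 ^ 2) *
        (x 3 0 ^ 2 + x 3 1 ^ 2))

/-- The basis `x_{i0}² + x_{i1}²`, `x_{i0}² - x_{i1}²`, `x_{i0} x_{i1}` of the quadratic forms in the
`i`-th pair of variables. -/
def quadric (i : Fin 4) : Fin 3 → R :=
  ![x i 0 ^ 2 + x i 1 ^ 2, x i 0 ^ 2 - x i 1 ^ 2, x i 0 * x i 1]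

/-- The products of basis quadrics, which span the forms of multidegree `(2,2,2,2)`. -/
def quadricProd (a b c d : Fin 3) : R :=
  quadric 0 a * quadric 1 b * quadric 2 c * quadric 3 d

/-- The sign of a basis quadric under `x_{i1} ↦ -x_{i1}`. -/
def signChar : Fin 3 → ℂ := ![1, 1, -1]

/-- The sign of a basis quadric under `x_{i0} ↔ x_{i1}`. -/
def swapChar : Fin 3 → ℂ := ![1, -1, 1]

lemma signChar_mul_self (a : Fin 3) : signChar a * signChar a = 1 := by
  fin_cases a <;> simp [signChar]

lemma swapChar_mul_self (a : Fin 3) : swapChar a * swapChar a = 1 := by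
  fin_cases a <;> simp [swapChar]

lemma gstar_x (i : Fin 4) (j : Fin 2) :
    gstar (x i j) = ![fun j => x 1 j, fun j => ((-1 : ℂ) ^ (j : ℕ)) • x 0 j,
      fun j => x 3 j, fun j => ((-1 : ℂ) ^ (j : ℕ)) • x 2 j] i j := by
  simp only [gstar, x, aeval_X]

lemma hstar_x (i : Fin 4) (j : Fin 2) :
    hstar (x i j) = ![fun j => x 2 (j + 1), fun j => ((-1 : ℂ) ^ (1 - (j : ℕ))) • x 3 (j + 1),
      fun j => x 0 j, fun j => ((-1 : ℂ) ^ (j : ℕ)) • x 1 j] i j := by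
  simp only [hstar, x, aeval_X]

lemma gstar_quadric (a : Fin 3) :
    gstar (quadric 0 a) = quadric 1 a ∧ gstar (quadric 1 a) = signChar a • quadric 0 a ∧
    gstar (quadric 2 a) = quadric 3 a ∧ gstar (quadric 3 a) = signChar a • quadric 2 a := by
  fin_cases a <;> simp [quadric, gstar_x, signChar]

lemma hstar_quadric (a : Fin 3) :
    hstar (quadric 0 a) = swapChar a • quadric 2 a ∧
    hstar (quadric 1 a) = (swapChar a * signChar a) • quadric 3 a ∧
    hstar (quadric 2 a) = quadric 0 a ∧ hstar (quadric 3 a) = signChar a • quadric 1 a := by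
  fin_cases a <;> simp [quadric, hstar_x, signChar, swapChar] <;> ring_nf <;> simp

lemma gstar_quadricProd (a b c d : Fin 3) :
    gstar (quadricProd a b c d) = (signChar b * signChar d) • quadricProd b a d c := by
  simp only [quadricProd, map_mul, (gstar_quadric _).1, (gstar_quadric _).2.1,
    (gstar_quadric _).2.2.1, (gstar_quadric _).2.2.2, smul_eq_C_mul]
  ring

lemma hstar_quadricProd (a b c d : Fin 3) :
    hstar (quadricProd a b c d) =
      (swapChar a * swapChar b * signChar b * signChar d) • quadricProd c d a b := by
  simp only [quadricProd, map_mul, (hstar_quadric _).1, (hstar_quadric _).2.1,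
    (hstar_quadric _).2.2.1, (hstar_quadric _).2.2.2, smul_eq_C_mul]
  ring

/-- The unnormalised averaging operator of the group generated by `g*` and `h*`. -/
def average : R →ₗ[ℂ] R :=
  (1 + hstar.toLinearMap) * (1 + gstar.toLinearMap) *
    (1 + hstar.toLinearMap ^ 2) * (1 + gstar.toLinearMap ^ 2)

lemma average_of_fixed {p : R} (hg : gstar p = p) (hh : hstar p = p) :
    average p = (16 : ℂ) • p := by
  simp only [average, Module.End.mul_apply, LinearMap.add_apply, Module.End.one_apply, pow_two,
    AlgHom.toLinearMap_apply, map_add, hg, hh]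
  module

lemma average_quadricProd (a b c d : Fin 3) :
    average (quadricProd a b c d) =
      ((1 + signChar a * signChar b * signChar c * signChar d) *
        (1 + swapChar a * swapChar b * swapChar c * swapChar d)) •
      (quadricProd a b c d + (signChar b * signChar d) • quadricProd b a d c +
        (swapChar a * swapChar b * signChar b * signChar d) • quadricProd c d a b +
        (swapChar a * swapChar b * signChar a * signChar b * signChar c * signChar d) •
          quadricProd d c b a) := by
  have hgg : gstar (gstar (quadricProd a b c d)) =
      (signChar a * signChar b * signChar c * signChar d) • quadricProd a b c d := by
    rw [gstar_quadricProd, map_smul, gstar_quadricProd, smul_smul]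
    congr 1; ring
  have hhh : hstar (hstar (quadricProd a b c d)) =
      (swapChar a * swapChar b * swapChar c * swapChar d) • quadricProd a b c d := by
    rw [hstar_quadricProd, map_smul, hstar_quadricProd, smul_smul]
    congr 1
    linear_combination (swapChar a * swapChar b * swapChar c * swapChar d) *
      (signChar b * signChar b * signChar_mul_self d + signChar_mul_self b)
  simp only [average, Module.End.mul_apply, LinearMap.add_apply, Module.End.one_apply, pow_two,
    AlgHom.toLinearMap_apply, map_add, map_smul, hgg, hhh]
  simp only [gstar_quadricProd, map_smul, hstar_quadricProd]
  module

/-- The span of the invariants `U0, …, U5`. -/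
abbrev spanU : Submodule ℂ R := Submodule.span ℂ ({U0, U1, U2, U3, U4, U5} : Set R)

lemma combination_mem_spanU (c₀ c₁ c₂ c₃ c₄ c₅ : ℂ) {p : R}
    (h : p = C c₀ * U0 + C c₁ * U1 + C c₂ * U2 + C c₃ * U3 + C c₄ * U4 + C c₅ * U5) :
    p ∈ spanU := by
  simp only [h, ← smul_eq_C_mul]
  refine add_mem (add_mem (add_mem (add_mem (add_mem ?_ ?_) ?_) ?_) ?_) ?_ <;>
    exact Submodule.smul_mem _ _ (Submodule.subset_span (by simp))

lemma C_one_half_mul_two : (C (1 / 2 : ℂ) : R) * 2 = 1 := by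
  rw [show (2 : R) = C 2 from (map_ofNat C 2).symm, ← C_mul]
  norm_num

lemma C_one_quarter_mul_four : (C (1 / 4 : ℂ) : R) * 4 = 1 := by
  rw [show (4 : R) = C 4 from (map_ofNat C 4).symm, ← C_mul]
  norm_num

lemma quadricProd_ssss_mem : quadricProd 0 0 0 0 ∈ spanU := by
  refine combination_mem_spanU 2 0 1 1 2 (-2) ?_
  simp only [quadricProd, quadric, U5, Matrix.cons_val, map_neg, map_ofNat, map_zero, map_one]
  linear_combination (U2 + U3 - (x 0 0 ^ 2 + x 0 1 ^ 2) * (x 1 0 ^ 2 + x 1 1 ^ 2) *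
    (x 2 0 ^ 2 + x 2 1 ^ 2) * (x 3 0 ^ 2 + x 3 1 ^ 2)) * C_one_half_mul_two

lemma quadricProd_dddd_mem : quadricProd 1 1 1 1 ∈ spanU := by
  have h : quadricProd 1 1 1 1 = C 2 * U2 + C 2 * U3 - quadricProd 0 0 0 0 := by
    simp only [quadricProd, quadric, U2, U3, Matrix.cons_val, map_ofNat]
    ring
  rw [h]
  exact sub_mem (combination_mem_spanU 0 0 2 2 0 0 (by simp)) quadricProd_ssss_mem

lemma quadricProd_mmmm_mem : quadricProd 2 2 2 2 ∈ spanU := by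
  refine combination_mem_spanU 0 0 0 0 (1 / 4) 0 ?_
  simp only [quadricProd, quadric, U4, Matrix.cons_val, map_zero]
  linear_combination -(x 0 0 * x 0 1 * x 1 0 * x 1 1 * x 2 0 * x 2 1 * x 3 0 * x 3 1) *
    C_one_quarter_mul_four

lemma quadricProd_ddss_add_mem : quadricProd 1 1 0 0 + quadricProd 0 0 1 1 ∈ spanU := by
  refine combination_mem_spanU 0 0 2 (-2) 0 0 ?_
  simp only [quadricProd, quadric, U2, U3, Matrix.cons_val, map_neg, map_ofNat, map_zero]
  ring

lemma quadricProd_msms_add_mem : quadricProd 2 0 2 0 + quadricProd 0 2 0 2 ∈ spanU := by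
  refine combination_mem_spanU 0 1 0 0 0 0 ?_
  simp only [quadricProd, quadric, U1, Matrix.cons_val, map_zero, map_one]
  ring

lemma quadricProd_smms_sub_mem : quadricProd 0 2 2 0 - quadricProd 2 0 0 2 ∈ spanU := by
  refine combination_mem_spanU 1 0 0 0 0 0 ?_
  simp only [quadricProd, quadric, U0, Matrix.cons_val, map_zero, map_one]
  ring

lemma average_quadricProd_mem (a b c d : Fin 3) : average (quadricProd a b c d) ∈ spanU := by
  have mem_of_eq_smul : ∀ {p q : R} (k : ℂ), q ∈ spanU → p = k • q → p ∈ spanU := by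
    rintro p q k hq rfl
    exact Submodule.smul_mem _ _ hq
  rw [average_quadricProd]
  fin_cases a <;> fin_cases b <;> fin_cases c <;> fin_cases d <;>
    simp only [signChar, swapChar, Fin.zero_eta, Fin.mk_one, Fin.reduceFinMk, Matrix.cons_val,
      Fin.isValue] <;>
    first
    | exact mem_of_eq_smul 0 (zero_mem _) (by module)
    | exact mem_of_eq_smul 16 quadricProd_ssss_mem (by module)
    | exact mem_of_eq_smul 16 quadricProd_dddd_mem (by module)
    | exact mem_of_eq_smul 16 quadricProd_mmmm_mem (by module)
    | exact mem_of_eq_smul 8 quadricProd_ddss_add_mem (by module)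
    | exact mem_of_eq_smul 8 quadricProd_msms_add_mem (by module)
    | exact mem_of_eq_smul 8 quadricProd_smms_sub_mem (by module)
    | exact mem_of_eq_smul (-8) quadricProd_smms_sub_mem (by module)

lemma exists_eq_sum_quadric (i : Fin 4) {a b : ℕ} (h : a + b = 2) :
    ∃ k : Fin 3 → ℂ, x i 0 ^ a * x i 1 ^ b = ∑ t, C (k t) * quadric i t := by
  obtain ⟨rfl, rfl⟩ | ⟨rfl, rfl⟩ | ⟨rfl, rfl⟩ :
      (a = 2 ∧ b = 0) ∨ (a = 0 ∧ b = 2) ∨ (a = 1 ∧ b = 1) := by omega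
  · refine ⟨![1 / 2, 1 / 2, 0], ?_⟩
    simp only [Fin.sum_univ_three, quadric, Matrix.cons_val, map_zero]
    linear_combination -x i 0 ^ 2 * C_one_half_mul_two
  · refine ⟨![1 / 2, -(1 / 2), 0], ?_⟩
    simp only [Fin.sum_univ_three, quadric, Matrix.cons_val, map_zero, map_neg]
    linear_combination -x i 1 ^ 2 * C_one_half_mul_two
  · exact ⟨![0, 0, 1], by simp [Fin.sum_univ_three, quadric]⟩

lemma average_monomial_mem {m : Fin 4 × Fin 2 →₀ ℕ} (hm : ∀ i : Fin 4, m (i, 0) + m (i, 1) = 2)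
    (r : ℂ) : average (monomial m r) ∈ spanU := by
  have hprod : monomial m r = C r * ∏ i : Fin 4, (x i 0 ^ m (i, 0) * x i 1 ^ m (i, 1)) := by
    rw [monomial_eq, Finsupp.prod_fintype _ _ (fun _ => pow_zero _), Fintype.prod_prod_type]
    simp only [Fin.prod_univ_two, x]
  choose k hk using fun i => exists_eq_sum_quadric i (hm i)
  simp only [hprod, hk, Finset.prod_univ_sum, ← smul_eq_C_mul, map_smul, map_sum]
  refine Submodule.smul_mem _ _ (Submodule.sum_mem _ fun f _ => ?_)
  have hf : ∏ i, k i (f i) • quadric i (f i) =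
      (∏ i, k i (f i)) • quadricProd (f 0) (f 1) (f 2) (f 3) := by
    rw [Finset.prod_smul, Fin.prod_univ_four (fun i => quadric i (f i)), quadricProd]
  rw [hf, map_smul]
  exact Submodule.smul_mem _ _ (average_quadricProd_mem _ _ _ _)

lemma mem_spanU_of_fixed {p : R}
    (hp : ∀ m ∈ p.support, ∀ i : Fin 4, m (i, 0) + m (i, 1) = 2)
    (hg : gstar p = p) (hh : hstar p = p) : p ∈ spanU := by
  have hmem : average p ∈ spanU := by
    rw [p.as_sum, map_sum]
    exact Submodule.sum_mem _ fun m hm => average_monomial_mem (hp m hm) _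
  rw [average_of_fixed hg hh] at hmem
  exact (Submodule.smul_mem_iff _ (by norm_num)).1 hmem

lemma linearIndependent_U : LinearIndependent ℂ ![U0, U1, U2, U3, U4, U5] := by
  rw [Fintype.linearIndependent_iff]
  intro c hc
  have key : ∀ v : Fin 4 → Fin 2 → ℂ,
      eval (fun p => v p.1 p.2) (∑ i, c i • ![U0, U1, U2, U3, U4, U5] i) = 0 := by
    intro v
    rw [hc, map_zero]
  simp only [Fin.sum_univ_six, Matrix.cons_val, U0, U1, U2, U3, U4, U5, x, smul_eval, map_add,
    map_sub, map_mul, map_pow, map_ofNat, eval_X, eval_C] at key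
  have h₂ := key ![![1, 0], ![1, 0], ![1, 0], ![1, 0]]
  have h₃ := key ![![0, 1], ![1, 0], ![0, 1], ![1, 0]]
  have h₅ := key ![![0, 1], ![1, 0], ![1, 0], ![1, 0]]
  have h₀ := key ![![1, 0], ![1, 1], ![1, 1], ![1, 0]]
  have h₁ := key ![![1, 1], ![1, 0], ![1, 1], ![1, 0]]
  have h₄ := key ![![1, 1], ![1, 1], ![1, 1], ![1, 1]]
  simp only [Matrix.cons_val] at h₀ h₁ h₂ h₃ h₄ h₅
  clear key hc
  norm_num at h₀ h₁ h₂ h₃ h₄ h₅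
  intro i
  fin_cases i <;> simp <;> grind

/-- every multidegree-(2,2,2,2) polynomial fixed by `g*` and `h*`
is a linear combination of `U0,…,U5`, and `U0,…,U5` are linearly independent. -/
theorem stmt_6 :
    (∀ p : R,
        (∀ m ∈ p.support, ∀ i : Fin 4, m (i, 0) + m (i, 1) = 2) →
        gstar p = p → hstar p = p →
        p ∈ Submodule.span ℂ ({U0, U1, U2, U3, U4, U5} : Set R)) ∧
    LinearIndependent ℂ ![U0, U1, U2, U3, U4, U5] := by
  exact ⟨fun _ => mem_spanU_of_fixed, linearIndependent_U⟩
end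
end
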